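/- Let X be a real Hilbert space, H ∈ L(X) a strictly positive self-adjoint bounded operator (H* = H and ⟨Hx, x⟩ > 0 for all x ≠ 0), and {x(k), k ≥ 0} a sequence of strongly measurable X-valued random elements with sup_k E[‖x(k)‖²] < ∞. If {μ(k), k ≥ 0} and {γ(k), k ≥ 0} are sequences of positive reals monotonically decreasing to 0 with ∑_{k=0}^∞ μ(k) = ∞ and ∑_{k=0}^∞ γ(k) < ∞, then lim_{k→∞} ∑_{i=0}^k γ(i) (E[‖(∏_{j=i+1}^k (I − μ(j)H)) x(i)‖²])^{1/2} = 0, where ∏_{j=i+1}^k (I − μ(j)H) denotes the composition (I − μ(k)H)(I − μ(k−1)H)⋯(I − μ(i+1)H) (equal to I when i ≥ k). -/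

import Mathlib

open MeasureTheory Filter ENNReal RealInnerProductSpace

noncomputable section

/-- The ordered product `A(m) ∘ A(m−1) ∘ ⋯ ∘ A(n+1)` (the identity when `m ≤ n`). -/
def opProdIoc {E : Type*} [NormedAddCommGroup E] [NormedSpace ℝ E]
    (A : ℕ → E →L[ℝ] E) (n m : ℕ) : E →L[ℝ] E :=
  (((List.range' (n + 1) (m - n)).reverse).map A).prod

section GradientDescent

variable {X : Type*} [NormedAddCommGroup X] [InnerProductSpace ℝ X] {H : X →L[ℝ] X}

/-- Cocoercivity of a positive operator: `‖H v‖² ≤ L ⟪H v, v⟫` as soon as `‖H‖ ≤ L`. -/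
theorem norm_sq_apply_le_mul_inner (hsa : ∀ x y : X, ⟪H x, y⟫ = ⟪x, H y⟫)
    (hpos : ∀ x : X, 0 ≤ ⟪H x, x⟫) {L : ℝ} (hL : 0 < L) (hHL : ‖H‖ ≤ L) (v : X) :
    ‖H v‖ ^ 2 ≤ L * ⟪H v, v⟫ := by
  have h1 := hpos (L • v - H v)
  have h2 : ⟪H (H v), H v⟫ ≤ L * ‖H v‖ ^ 2 := by
    calc ⟪H (H v), H v⟫ ≤ ‖H (H v)‖ * ‖H v‖ := real_inner_le_norm _ _
      _ ≤ (L * ‖H v‖) * ‖H v‖ := by gcongr; exact H.le_of_opNorm_le hHL _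
      _ = L * ‖H v‖ ^ 2 := by ring
  have h3 : ⟪H (L • v - H v), L • v - H v⟫
      = L ^ 2 * ⟪H v, v⟫ - 2 * L * ‖H v‖ ^ 2 + ⟪H (H v), H v⟫ := by
    simp only [map_sub, map_smul, inner_sub_left, inner_sub_right, real_inner_smul_left,
      real_inner_smul_right, hsa (H v) v, real_inner_self_eq_norm_sq]
    ring
  have h4 : 0 ≤ L * (L * ⟪H v, v⟫ - ‖H v‖ ^ 2) := by nlinarith
  linarith [nonneg_of_mul_nonneg_right h4 hL]

theorem norm_sq_sub_smul_apply_le (hsa : ∀ x y : X, ⟪H x, y⟫ = ⟪x, H y⟫)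
    (hpos : ∀ x : X, 0 ≤ ⟪H x, x⟫) {L : ℝ} (hL : 0 < L) (hHL : ‖H‖ ≤ L) {t : ℝ} (ht : 0 ≤ t)
    (htL : t * L ≤ 1) (v : X) :
    ‖v - t • H v‖ ^ 2 ≤ ‖v‖ ^ 2 - t * (‖H v‖ ^ 2 / L) := by
  have h1 := norm_sq_apply_le_mul_inner hsa hpos hL hHL v
  have h2 : ‖H v‖ ^ 2 / L ≤ ⟪H v, v⟫ := by rwa [div_le_iff₀' hL]
  have h3 : ‖v - t • H v‖ ^ 2 = ‖v‖ ^ 2 - 2 * (t * ⟪H v, v⟫) + t * (t * ‖H v‖ ^ 2) := by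
    rw [norm_sub_sq_real, real_inner_smul_right, norm_smul, real_inner_comm, mul_pow,
      Real.norm_eq_abs, sq_abs]
    ring
  have h4 : t * ‖H v‖ ^ 2 ≤ ⟪H v, v⟫ := by
    calc t * ‖H v‖ ^ 2 ≤ t * (L * ⟪H v, v⟫) := by gcongr
      _ = (t * L) * ⟪H v, v⟫ := by ring
      _ ≤ 1 * ⟪H v, v⟫ := by gcongr; exact hpos v
      _ = _ := one_mul _
  have h5 := mul_le_mul_of_nonneg_left h4 ht
  have h6 := mul_le_mul_of_nonneg_left h2 ht
  linarith

theorem norm_sub_smul_apply_le (hsa : ∀ x y : X, ⟪H x, y⟫ = ⟪x, H y⟫)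
    (hpos : ∀ x : X, 0 ≤ ⟪H x, x⟫) {L : ℝ} (hL : 0 < L) (hHL : ‖H‖ ≤ L) {t : ℝ} (ht : 0 ≤ t)
    (htL : t * L ≤ 1) (v : X) : ‖v - t • H v‖ ≤ ‖v‖ := by
  have h := norm_sq_sub_smul_apply_le hsa hpos hL hHL ht htL v
  have h' : 0 ≤ t * (‖H v‖ ^ 2 / L) := by positivity
  exact le_of_sq_le_sq (by linarith) (norm_nonneg _)

/-- A strictly positive operator has dense range. -/
theorem denseRange_of_inner_pos [CompleteSpace X] (hpos : ∀ x : X, x ≠ 0 → 0 < ⟪H x, x⟫) :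
    DenseRange H := by
  have h : (LinearMap.range (H : X →ₗ[ℝ] X))ᗮ = ⊥ := by
    rw [Submodule.eq_bot_iff]
    intro y hy
    by_contra hne
    have := hpos y hne
    rw [(Submodule.mem_orthogonal _ _).1 hy (H y) ⟨y, rfl⟩] at this
    exact lt_irrefl _ this
  exact Submodule.dense_iff_topologicalClosure_eq_top.2
    (Submodule.topologicalClosure_eq_top_iff.2 h)

/-- Gradient descent for a strictly positive operator, with small non-summable step sizes,
converges to `0`. -/
theorem tendsto_zero_of_descent_of_step_le [CompleteSpace X]
    (hsa : ∀ x y : X, ⟪H x, y⟫ = ⟪x, H y⟫) (hpos : ∀ x : X, x ≠ 0 → 0 < ⟪H x, x⟫)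
    {L : ℝ} (hL : 0 < L) (hHL : ‖H‖ ≤ L) {s : ℕ → ℝ} (hs : ∀ k, 0 ≤ s k)
    (hsL : ∀ k, s k * L ≤ 1) (hdiv : ¬ Summable s) {w : ℕ → X}
    (hw : ∀ k, w (k + 1) = w k - s k • H (w k)) : Tendsto w atTop (nhds 0) := by
  have hnn : ∀ x : X, 0 ≤ ⟪H x, x⟫ := fun x => by
    rcases eq_or_ne x 0 with rfl | hx
    · simp
    · exact (hpos x hx).le
  have anti : ∀ u : ℕ → X, (∀ k, u (k + 1) = u k - s k • H (u k)) →
      Antitone fun k => ‖u k‖ := fun u hu =>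
    antitone_nat_of_succ_le fun k => by
      rw [hu]
      exact norm_sub_smul_apply_le hsa hnn hL hHL (hs k) (hsL k) (u k)
  rw [Metric.tendsto_atTop]
  intro ε hε
  obtain ⟨z, hz⟩ := (denseRange_of_inner_pos hpos).exists_dist_lt (w 0) (half_pos hε)
  obtain ⟨v, hv0, hv⟩ : ∃ v : ℕ → X, v 0 = z ∧ ∀ k, v (k + 1) = v k - s k • H (v k) :=
    ⟨fun k => Nat.rec z (fun k y => y - s k • H y) k, rfl, fun _ => rfl⟩
  have hHv : ∀ k, H (v (k + 1)) = H (v k) - s k • H (H (v k)) := fun k => by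
    rw [hv, map_sub, map_smul]
  have hHv_anti := anti (fun k => H (v k)) hHv
  have hdiff := anti (fun k => w k - H (v k)) fun k => by
    simp only [hw, hHv, map_sub, smul_sub]
    abel
  obtain ⟨N, hN⟩ : ∃ N, ‖H (v N)‖ < ε / 2 := by
    by_contra! hcon
    refine hdiv (summable_of_sum_range_le (c := ‖v 0‖ ^ 2 / ((ε / 2) ^ 2 / L)) hs fun n => ?_)
    rw [le_div_iff₀ (by positivity), Finset.sum_mul]
    have key : ∑ i ∈ Finset.range n, s i * ((ε / 2) ^ 2 / L) ≤ ‖v 0‖ ^ 2 - ‖v n‖ ^ 2 := by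
      rw [← Finset.sum_range_sub' (fun i => ‖v i‖ ^ 2)]
      refine Finset.sum_le_sum fun i _ => ?_
      have h1 := norm_sq_sub_smul_apply_le hsa hnn hL hHL (hs i) (hsL i) (v i)
      rw [← hv] at h1
      have h2 : s i * ((ε / 2) ^ 2 / L) ≤ s i * (‖H (v i)‖ ^ 2 / L) := by
        gcongr
        · exact hs i
        · exact hcon i
      linarith
    linarith [sq_nonneg ‖v n‖]
  refine ⟨N, fun n hn => ?_⟩
  have h1 : ‖H (v n)‖ ≤ ‖H (v N)‖ := hHv_anti hn
  have h2 : ‖w n - H (v n)‖ ≤ ‖w 0 - H (v 0)‖ := hdiff (Nat.zero_le n)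
  rw [hv0, ← dist_eq_norm (w 0)] at h2
  rw [dist_zero_right]
  calc ‖w n‖ = ‖(w n - H (v n)) + H (v n)‖ := by rw [sub_add_cancel]
    _ ≤ ‖w n - H (v n)‖ + ‖H (v n)‖ := norm_add_le _ _
    _ < ε := by linarith

end GradientDescent

section OpProd

variable {E : Type*} [NormedAddCommGroup E] [NormedSpace ℝ E] (A : ℕ → E →L[ℝ] E)

theorem opProdIoc_of_le {n m : ℕ} (h : m ≤ n) : opProdIoc A n m = 1 := by
  simp [opProdIoc, Nat.sub_eq_zero_of_le h]

theorem opProdIoc_succ {n m : ℕ} (h : n ≤ m) :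
    opProdIoc A n (m + 1) = A (m + 1) * opProdIoc A n m := by
  have h1 : m + 1 - n = (m - n) + 1 := by omega
  have h2 : n + 1 + (m - n) = m + 1 := by omega
  simp [opProdIoc, h1, List.range'_concat, h2]

variable {A}

theorem norm_opProdIoc_apply_le_prod (n m : ℕ) (y : E) :
    ‖opProdIoc A n m y‖ ≤ (∏ j ∈ Finset.range (m + 1), max 1 ‖A j‖) * ‖y‖ := by
  have one_le : ∀ m, 1 ≤ ∏ j ∈ Finset.range (m + 1), max 1 ‖A j‖ := fun m =>
    Finset.one_le_prod fun j _ => le_max_left _ _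
  have base : ∀ m ≤ n, ‖opProdIoc A n m y‖
      ≤ (∏ j ∈ Finset.range (m + 1), max 1 ‖A j‖) * ‖y‖ := fun m hm => by
    rw [opProdIoc_of_le A hm]
    exact le_mul_of_one_le_left (norm_nonneg y) (one_le m)
  rcases le_total m n with hm | hm
  · exact base m hm
  induction m, hm using Nat.le_induction with
  | base => exact base n le_rfl
  | succ m hm ih =>
    rw [opProdIoc_succ A hm, Finset.prod_range_succ]
    calc ‖A (m + 1) (opProdIoc A n m y)‖ ≤ ‖A (m + 1)‖ * ‖opProdIoc A n m y‖ :=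
          (A (m + 1)).le_opNorm _
      _ ≤ max 1 ‖A (m + 1)‖ * ((∏ j ∈ Finset.range (m + 1), max 1 ‖A j‖) * ‖y‖) := by
          gcongr
          exact le_max_right _ _
      _ = _ := by ring

/-- Ordered products of operators that are eventually contractions are uniformly bounded. -/
theorem exists_norm_opProdIoc_apply_le (hA : ∀ᶠ j in atTop, ‖A j‖ ≤ 1) :
    ∃ C : ℝ, 0 ≤ C ∧ ∀ n m y, ‖opProdIoc A n m y‖ ≤ C * ‖y‖ := by
  obtain ⟨N, hN⟩ := eventually_atTop.1 hA
  refine ⟨∏ j ∈ Finset.range N, max 1 ‖A j‖, by positivity, fun n m y =>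
    (norm_opProdIoc_apply_le_prod n m y).trans (mul_le_mul_of_nonneg_right ?_ (norm_nonneg y))⟩
  rw [Finset.prod_subset (Finset.range_mono (le_max_right (m + 1) N))
    (f := fun j => max 1 ‖A j‖) fun j _ hj => max_eq_left (hN j (by simpa using hj))]
  exact Finset.prod_le_prod_of_subset_of_one_le
    (Finset.range_mono (le_max_left _ _)) (fun _ _ => by positivity) fun _ _ _ => le_max_left _ _

end OpProd

theorem eventually_mul_le_one {μ : ℕ → ℝ} (hμ_lim : Tendsto μ atTop (nhds 0)) (L : ℝ) :
    ∀ᶠ k in atTop, μ k * L ≤ 1 := by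
  have h : Tendsto (fun k => μ k * L) atTop (nhds 0) := by simpa using hμ_lim.mul_const L
  exact h.eventually (ge_mem_nhds one_pos)

/-- The products `(I - μ(k) H) ⋯ (I - μ(i+1) H)` converge strongly to `0`. -/
theorem tendsto_opProdIoc_apply_zero {X : Type*} [NormedAddCommGroup X] [InnerProductSpace ℝ X]
    [CompleteSpace X] {H : X →L[ℝ] X} (hsa : ∀ x y : X, ⟪H x, y⟫ = ⟪x, H y⟫)
    (hpos : ∀ x : X, x ≠ 0 → 0 < ⟪H x, x⟫) {μ : ℕ → ℝ} (hμ_pos : ∀ k, 0 ≤ μ k)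
    (hμ_lim : Tendsto μ atTop (nhds 0)) (hμ_div : ¬ Summable μ) (i : ℕ) (y : X) :
    Tendsto (fun k => opProdIoc (fun j => 1 - μ j • H) i k y) atTop (nhds 0) := by
  obtain ⟨N, hN⟩ := eventually_atTop.1 (eventually_mul_le_one hμ_lim (‖H‖ + 1))
  rw [← tendsto_add_atTop_iff_nat (N + i)]
  refine tendsto_zero_of_descent_of_step_le hsa hpos (L := ‖H‖ + 1) (by positivity) (by simp)
    (s := fun k => μ (k + (N + i + 1))) (fun k => hμ_pos _) (fun k => hN _ (by omega))
    (by rwa [summable_nat_add_iff]) fun k => ?_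
  rw [show k + 1 + (N + i) = k + (N + i) + 1 by ring, opProdIoc_succ _ (by omega)]
  simp [add_assoc]

/-- Dominated convergence for partial sums in `ℝ≥0∞`. -/
theorem ENNReal.tendsto_sum_range_zero_of_dominated {a : ℕ → ℕ → ℝ≥0∞} {b : ℕ → ℝ≥0∞}
    (hb : ∑' i, b i ≠ ∞) (hab : ∀ k i, a k i ≤ b i)
    (ha : ∀ i, Tendsto (fun k => a k i) atTop (nhds 0)) :
    Tendsto (fun k => ∑ i ∈ Finset.range (k + 1), a k i) atTop (nhds 0) := by
  have h : Tendsto (fun k => ∑' i, a k i) atTop (nhds 0) := by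
    have := tendsto_lintegral_of_dominated_convergence (μ := Measure.count) (F := a)
      (f := fun _ => 0) b (fun _ => measurable_from_nat) (fun k => ae_of_all _ (hab k))
      (by rwa [lintegral_count]) (ae_of_all _ ha)
    simpa [lintegral_count] using this
  exact tendsto_of_tendsto_of_tendsto_of_le_of_le tendsto_const_nhds h (fun _ => zero_le)
    fun k => ENNReal.sum_le_tsum _

/-- Lemma C.4. Let `X` be a real Hilbert space, `H ∈ L(X)` a strictly positive
self-adjoint bounded operator, `{x(k)}` an `L₂`-bounded sequence of strongly measurable `X`-valued
random elements, and `{μ(k)}`, `{γ(k)}` positive reals monotonically decreasing to `0` with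
`∑ μ(k) = ∞` and `∑ γ(k) < ∞`. Then
`∑_{i=0}^k γ(i) (E[‖(∏_{j=i+1}^k (I − μ(j)H)) x(i)‖²])^{1/2} → 0` as `k → ∞`. -/
theorem decentralized_online_learning.stmt16
    {Ω : Type*} [MeasurableSpace Ω] (P : Measure Ω) [IsProbabilityMeasure P]
    {X : Type*} [NormedAddCommGroup X] [InnerProductSpace ℝ X] [CompleteSpace X]
    (H : X →L[ℝ] X)
    (hH_sa : ∀ x y : X, ⟪H x, y⟫ = ⟪x, H y⟫)
    (hH_pos : ∀ x : X, x ≠ 0 → 0 < ⟪H x, x⟫)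
    (x : ℕ → Ω → X)
    (hx_meas : ∀ k, StronglyMeasurable (x k))
    (hx_bdd : (⨆ k, ∫⁻ ω, (‖x k ω‖₊ : ℝ≥0∞) ^ 2 ∂P) < ⊤)
    (μ γ : ℕ → ℝ)
    (hμ_pos : ∀ k, 0 < μ k) (hμ_anti : Antitone μ) (hμ_lim : Tendsto μ atTop (nhds 0))
    (hγ_pos : ∀ k, 0 < γ k) (hγ_anti : Antitone γ) (hγ_lim : Tendsto γ atTop (nhds 0))
    (hμ_div : ¬ Summable μ)
    (hγ_sum : Summable γ) :
    Tendsto (fun k => ∑ i ∈ Finset.range (k + 1),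
        ENNReal.ofReal (γ i) *
          (∫⁻ ω, (‖opProdIoc (fun j => 1 - μ j • H) i k (x i ω)‖₊ : ℝ≥0∞) ^ 2 ∂P) ^ (1 / 2 : ℝ))
      atTop (nhds 0) := by
  set A : ℕ → X →L[ℝ] X := fun j => 1 - μ j • H with hA_def
  have hnn : ∀ y : X, 0 ≤ ⟪H y, y⟫ := fun y => by
    rcases eq_or_ne y 0 with rfl | hy
    · simp
    · exact (hH_pos y hy).le
  have hA : ∀ᶠ j in atTop, ‖A j‖ ≤ 1 := by
    filter_upwards [eventually_mul_le_one hμ_lim (‖H‖ + 1)] with j hj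
    refine ContinuousLinearMap.opNorm_le_bound _ zero_le_one fun y => ?_
    simpa [hA_def] using norm_sub_smul_apply_le hH_sa hnn (by positivity) (by simp)
      (hμ_pos j).le hj y
  obtain ⟨C, hC, hCb⟩ := exists_norm_opProdIoc_apply_le hA
  set S := ⨆ k, ∫⁻ ω, (‖x k ω‖₊ : ℝ≥0∞) ^ 2 ∂P
  have hpt : ∀ i k ω, (‖opProdIoc A i k (x i ω)‖₊ : ℝ≥0∞) ^ 2
      ≤ ENNReal.ofReal C ^ 2 * (‖x i ω‖₊ : ℝ≥0∞) ^ 2 := fun i k ω => by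
    rw [← mul_pow, ← enorm_eq_nnnorm, ← enorm_eq_nnnorm, ← ofReal_norm,
      ← ofReal_norm, ← ENNReal.ofReal_mul hC]
    gcongr
    exact hCb i k _
  have hmeas : ∀ i, Measurable fun ω => (‖x i ω‖₊ : ℝ≥0∞) ^ 2 := fun i =>
    (hx_meas i).enorm.pow_const 2
  have hle : ∀ i, ∫⁻ ω, ENNReal.ofReal C ^ 2 * (‖x i ω‖₊ : ℝ≥0∞) ^ 2 ∂P
      ≤ ENNReal.ofReal C ^ 2 * S := fun i => by
    rw [lintegral_const_mul _ (hmeas i)]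
    gcongr
    exact le_iSup (fun k => ∫⁻ ω, (‖x k ω‖₊ : ℝ≥0∞) ^ 2 ∂P) i
  have hfin : ENNReal.ofReal C ^ 2 * S ≠ ∞ :=
    ENNReal.mul_ne_top (ENNReal.pow_ne_top ENNReal.ofReal_ne_top) hx_bdd.ne
  refine ENNReal.tendsto_sum_range_zero_of_dominated
    (b := fun i => ENNReal.ofReal (γ i) * (ENNReal.ofReal C ^ 2 * S) ^ (1 / 2 : ℝ)) ?_ ?_ ?_
  · rw [ENNReal.tsum_mul_right]
    exact ENNReal.mul_ne_top hγ_sum.tsum_ofReal_ne_top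
      (ENNReal.rpow_ne_top_of_nonneg (by norm_num) hfin)
  · intro k i
    gcongr
    exact (lintegral_mono (hpt i k)).trans (hle i)
  · intro i
    have h : Tendsto (fun k => ∫⁻ ω, (‖opProdIoc A i k (x i ω)‖₊ : ℝ≥0∞) ^ 2 ∂P) atTop
        (nhds 0) := by
      rw [← lintegral_zero (μ := P)]
      refine tendsto_lintegral_of_dominated_convergence _
        (fun k => ((opProdIoc A i k).continuous.comp_stronglyMeasurable
          (hx_meas i)).enorm.pow_const 2)
        (fun k => ae_of_all _ (hpt i k)) ((hle i).trans_lt hfin.lt_top).ne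
        (ae_of_all _ fun ω => ?_)
      have h0 := tendsto_opProdIoc_apply_zero hH_sa hH_pos (fun k => (hμ_pos k).le) hμ_lim
        hμ_div i (x i ω)
      simpa [Function.comp_def, enorm_eq_nnnorm] using
        ((ENNReal.continuous_pow 2).tendsto _).comp ((continuous_enorm.tendsto _).comp h0)
    have h' := ENNReal.Tendsto.const_mul (a := ENNReal.ofReal (γ i))
      (((ENNReal.continuous_rpow_const (y := (1 / 2 : ℝ))).tendsto _).comp h)
      (Or.inr ENNReal.ofReal_ne_top)
    simpa using h'
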